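/- arXiv:2511.09673 — 5 statements merged into one kernel-verified Lean document; each statement's English description precedes it below -/
import Mathlib

section
/- The following 14 points form a 1⁺-separated subset of the unit sphere S_X of the Petty space (so the strict Hadwiger number satisfies H′(X) ≥ 14): the eight points aₖ with a₁ = (0.7·cos 0°, 0.7·sin 0°, 0.3), a₂ = (cos 45°, sin 45°, 0), a₃ = (0.7·cos 90°, 0.7·sin 90°, −0.3), a₄ = (cos 135°, sin 135°, 0), a₅ = (0.7·cos 180°, 0.7·sin 180°, 0.3), a₆ = (cos 225°, sin 225°, 0), a₇ = (0.7·cos 270°, 0.7·sin 270°, −0.3), a₈ = (cos 315°, sin 315°, 0); the four points b₁ = (0.501·cos 85°, 0.501·sin 85°, 0.499), b₂ = (0.501·cos 265°, 0.501·sin 265°, 0.499), b₃ = (0.501·cos 175°, 0.501·sin 175°, −0.499), b₄ = (0.501·cos 355°, 0.501·sin 355°, −0.499); and the two points e₃ = (0,0,1) and −e₃ = (0,0,−1). (Here an angle of α degrees means α·π/180 radians.) -/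
/-- The Petty norm on ℝ³: ‖(x,y,z)‖ = √(x²+y²) + |z|. -/
noncomputable def pettyNorm (a : ℝ × ℝ × ℝ) : ℝ :=
  Real.sqrt (a.1 ^ 2 + a.2.1 ^ 2) + |a.2.2|

/-- The Petty distance on ℝ³. -/
noncomputable def pettyDist (a b : ℝ × ℝ × ℝ) : ℝ := pettyNorm (a - b)

/-- The unit sphere of the Petty space. -/
def pettySphere : Set (ℝ × ℝ × ℝ) := {a | pettyNorm a = 1}

/-- A set is 1-separated if all pairwise Petty distances are ≥ 1. -/
def OneSeparated (S : Set (ℝ × ℝ × ℝ)) : Prop :=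
  ∀ a ∈ S, ∀ b ∈ S, a ≠ b → 1 ≤ pettyDist a b

/-- Angle of `α` degrees, in radians. -/
noncomputable def deg (α : ℝ) : ℝ := α * Real.pi / 180

/-- The 14-point configuration from Example 1. -/
noncomputable def pettyConfig : Fin 14 → ℝ × ℝ × ℝ
  | 0 => (0.7 * Real.cos (deg 0), 0.7 * Real.sin (deg 0), 0.3)
  | 1 => (Real.cos (deg 45), Real.sin (deg 45), 0)
  | 2 => (0.7 * Real.cos (deg 90), 0.7 * Real.sin (deg 90), -0.3)
  | 3 => (Real.cos (deg 135), Real.sin (deg 135), 0)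
  | 4 => (0.7 * Real.cos (deg 180), 0.7 * Real.sin (deg 180), 0.3)
  | 5 => (Real.cos (deg 225), Real.sin (deg 225), 0)
  | 6 => (0.7 * Real.cos (deg 270), 0.7 * Real.sin (deg 270), -0.3)
  | 7 => (Real.cos (deg 315), Real.sin (deg 315), 0)
  | 8 => (0.501 * Real.cos (deg 85), 0.501 * Real.sin (deg 85), 0.499)
  | 9 => (0.501 * Real.cos (deg 265), 0.501 * Real.sin (deg 265), 0.499)
  | 10 => (0.501 * Real.cos (deg 175), 0.501 * Real.sin (deg 175), -0.499)
  | 11 => (0.501 * Real.cos (deg 355), 0.501 * Real.sin (deg 355), -0.499)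
  | 12 => (0, 0, 1)
  | 13 => (0, 0, -1)

theorem one_lt_pettyNorm_of_sq_lt {x y z : ℝ} (h : (1 - |z|) ^ 2 < x ^ 2 + y ^ 2) :
    1 < pettyNorm (x, y, z) := by
  have := Real.lt_sqrt_of_sq_lt h
  simp only [pettyNorm]
  linarith

theorem pettyDist_comm (a b : ℝ × ℝ × ℝ) : pettyDist a b = pettyDist b a := by
  rw [pettyDist, pettyDist, pettyNorm, pettyNorm]
  simp only [Prod.fst_sub, Prod.snd_sub]
  rw [abs_sub_comm, sub_sq_comm a.1, sub_sq_comm a.2.1]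

theorem pettyNorm_smul_cos_sin {r : ℝ} (hr : 0 ≤ r) (θ z : ℝ) :
    pettyNorm (r * Real.cos θ, r * Real.sin θ, z) = r + |z| := by
  have h : (r * Real.cos θ) ^ 2 + (r * Real.sin θ) ^ 2 = r ^ 2 := by
    linear_combination r ^ 2 * Real.sin_sq_add_cos_sq θ
  simp only [pettyNorm, h, Real.sqrt_sq hr]

theorem pettyConfig_mem_pettySphere (i : Fin 14) : pettyConfig i ∈ pettySphere := by
  have h1 (θ : ℝ) : pettyNorm (Real.cos θ, Real.sin θ, 0) = 1 := by
    simpa using pettyNorm_smul_cos_sin zero_le_one θ 0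
  fin_cases i <;> simp only [pettyConfig, pettySphere, Set.mem_ofPred_eq, h1] <;>
    first
    | (rw [pettyNorm_smul_cos_sin (by norm_num)]; norm_num [abs_of_pos, abs_of_neg])
    | norm_num [pettyNorm]

/-- The points of `pettyConfig`, with `q`, `c`, `s` standing for the values `√2 / 2`, `cos 5°` and
`sin 5°`. -/
def algebraicConfig (q c s : ℝ) : Fin 14 → ℝ × ℝ × ℝ
  | 0 => (0.7, 0, 0.3)
  | 1 => (q, q, 0)
  | 2 => (0, 0.7, -0.3)
  | 3 => (-q, q, 0)
  | 4 => (-0.7, 0, 0.3)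
  | 5 => (-q, -q, 0)
  | 6 => (0, -0.7, -0.3)
  | 7 => (q, -q, 0)
  | 8 => (0.501 * s, 0.501 * c, 0.499)
  | 9 => (-(0.501 * s), -(0.501 * c), 0.499)
  | 10 => (-(0.501 * c), 0.501 * s, -0.499)
  | 11 => (0.501 * c, -(0.501 * s), -0.499)
  | 12 => (0, 0, 1)
  | 13 => (0, 0, -1)

theorem deg_add_ninety (α : ℝ) : deg (α + 90) = deg α + Real.pi / 2 := by
  unfold deg; ring

theorem cos_deg_add_ninety (α : ℝ) : Real.cos (deg (α + 90)) = -Real.sin (deg α) := by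
  rw [deg_add_ninety, Real.cos_add_pi_div_two]

theorem sin_deg_add_ninety (α : ℝ) : Real.sin (deg (α + 90)) = Real.cos (deg α) := by
  rw [deg_add_ninety, Real.sin_add_pi_div_two]

theorem pettyConfig_eq_algebraicConfig (i : Fin 14) :
    pettyConfig i =
      algebraicConfig (Real.sqrt 2 / 2) (Real.cos (deg 5)) (Real.sin (deg 5)) i := by
  have c0 : Real.cos (deg 0) = 1 := by simp [deg]
  have s0 : Real.sin (deg 0) = 0 := by simp [deg]
  have h45 : deg 45 = Real.pi / 4 := by unfold deg; ring
  have c45 : Real.cos (deg 45) = Real.sqrt 2 / 2 := by rw [h45, Real.cos_pi_div_four]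
  have s45 : Real.sin (deg 45) = Real.sqrt 2 / 2 := by rw [h45, Real.sin_pi_div_four]
  have h85 : deg 85 = Real.pi / 2 - deg 5 := by unfold deg; ring
  have c85 : Real.cos (deg 85) = Real.sin (deg 5) := by rw [h85, Real.cos_pi_div_two_sub]
  have s85 : Real.sin (deg 85) = Real.cos (deg 5) := by rw [h85, Real.sin_pi_div_two_sub]
  have e (α β : ℝ) (h : β = α + 90) :
      Real.cos (deg β) = -Real.sin (deg α) ∧ Real.sin (deg β) = Real.cos (deg α) := by
    subst h
    exact ⟨cos_deg_add_ninety α, sin_deg_add_ninety α⟩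
  fin_cases i <;>
    simp [pettyConfig, algebraicConfig, c0, s0, c45, s45, c85, s85,
      e 0 90 (by norm_num), e 90 180 (by norm_num), e 180 270 (by norm_num),
      e 45 135 (by norm_num), e 135 225 (by norm_num), e 225 315 (by norm_num),
      e 85 175 (by norm_num), e 175 265 (by norm_num), e 265 355 (by norm_num)]

theorem sin_deg_five_bounds : 0.087 < Real.sin (deg 5) ∧ Real.sin (deg 5) < 0.0873 := by
  have h1 := Real.pi_gt_d4
  have h2 := Real.pi_lt_d4
  have h5 : deg 5 = Real.pi / 36 := by unfold deg; ring
  have hl : 0.08726 < deg 5 := by rw [h5]; linarith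
  have hu : deg 5 < 0.08727 := by rw [h5]; linarith
  have hcube : deg 5 ^ 3 < 0.08727 ^ 3 := by gcongr
  constructor
  · have := Real.sin_gt_sub_cube (x := deg 5) (by linarith)
    linarith
  · linarith [Real.sin_lt (x := deg 5) (by linarith)]

theorem cos_deg_five_bounds : 0.996 < Real.cos (deg 5) ∧ Real.cos (deg 5) < 0.9965 := by
  obtain ⟨h1, h2⟩ := sin_deg_five_bounds
  have h := Real.sin_sq_add_cos_sq (deg 5)
  have hc : 0 ≤ Real.cos (deg 5) := by
    apply Real.cos_nonneg_of_neg_pi_div_two_le_of_le <;> unfold deg <;> linarith [Real.pi_pos]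
  constructor <;> nlinarith

theorem sqrt_two_div_two_bounds : 0.707 < Real.sqrt 2 / 2 ∧ Real.sqrt 2 / 2 < 0.7072 := by
  have h1 : (1.414 : ℝ) < Real.sqrt 2 := Real.lt_sqrt_of_sq_lt (by norm_num)
  have h2 : Real.sqrt 2 < (1.4144 : ℝ) := (Real.sqrt_lt' (by norm_num)).2 (by norm_num)
  constructor <;> linarith

set_option maxHeartbeats 1000000 in
theorem one_lt_pettyDist_algebraicConfig {q c s : ℝ} (hq : q ^ 2 = 1 / 2)
    (hcs : c ^ 2 = 1 - s ^ 2) (hq1 : 0.707 < q) (hq2 : q < 0.7072) (hc1 : 0.996 < c)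
    (hc2 : c < 0.9965) (hs1 : 0.087 < s) (hs2 : s < 0.0873) {i j : Fin 14} (hij : i < j) :
    1 < pettyDist (algebraicConfig q c s i) (algebraicConfig q c s j) := by
  have hqc1 : 0.704 < q * c := by nlinarith
  have hqc2 : q * c < 0.705 := by nlinarith
  have hqs1 : 0.061 < q * s := by nlinarith
  have hqs2 : q * s < 0.062 := by nlinarith
  fin_cases i <;> fin_cases j <;> first
    | exact absurd hij (by decide)
    | (simp only [algebraicConfig, pettyDist, Prod.mk_sub_mk]
       apply one_lt_pettyNorm_of_sq_lt
       norm_num [abs_of_pos, abs_of_neg]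
       done)
    | (simp only [algebraicConfig, pettyDist, Prod.mk_sub_mk]
       apply one_lt_pettyNorm_of_sq_lt
       norm_num [abs_of_pos, abs_of_neg, -one_lt_sq_iff_one_lt_abs]
       ring_nf
       simp only [hq, hcs]
       linarith)
    | norm_num [algebraicConfig, pettyDist, pettyNorm]

/-- the 14 points above lie on the Petty unit sphere and are pairwise at
Petty distance > 1, i.e. they form a 1⁺-separated subset of S_X, so H′(X) ≥ 14. -/
theorem pettyConfig_one_plus_separated :
    (∀ i, pettyConfig i ∈ pettySphere) ∧
    (∀ i j, i ≠ j → 1 < pettyDist (pettyConfig i) (pettyConfig j)) := by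
  refine ⟨pettyConfig_mem_pettySphere, fun i j hij => ?_⟩
  have hq : (Real.sqrt 2 / 2) ^ 2 = 1 / 2 := by
    rw [div_pow, Real.sq_sqrt (by norm_num)]; norm_num
  have key {i j : Fin 14} (h : i < j) :=
    one_lt_pettyDist_algebraicConfig hq (Real.cos_sq' (deg 5))
      sqrt_two_div_two_bounds.1 sqrt_two_div_two_bounds.2
      cos_deg_five_bounds.1 cos_deg_five_bounds.2
      sin_deg_five_bounds.1 sin_deg_five_bounds.2 h
  rw [pettyConfig_eq_algebraicConfig, pettyConfig_eq_algebraicConfig]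
  rcases lt_or_gt_of_ne hij with h | h
  · exact key h
  · rw [pettyDist_comm]
    exact key h
end

section
/- Let A, B, K be points of the Euclidean plane ℝ² and let ρ, R, r > 0 with R ≥ ρ. Suppose the closed discs of centers A, B, K and radii ρ, R, r satisfy: disc (A,ρ) and disc (B,R) are tangent (dist(A,B) = ρ + R), disc (K,r) is tangent to disc (A,ρ) (dist(A,K) = ρ + r), and disc (K,r) has interior disjoint from disc (B,R) (dist(B,K) ≥ R + r). Then the disc (K,r) has no point in common with the half-line from A through B; that is, dist(K, A + t·(B − A)) > r for every t ≥ 0. -/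
/-- if disc (A,ρ) is tangent to disc (B,R) with R ≥ ρ, disc (K,r) is tangent
to disc (A,ρ) and has interior disjoint from disc (B,R), then disc (K,r) misses the
half-line from A through B. -/
theorem disc_misses_halfline (A B K : EuclideanSpace ℝ (Fin 2)) (ρ R r : ℝ)
    (hρ : 0 < ρ) (hR : 0 < R) (hr : 0 < r) (hRρ : ρ ≤ R)
    (hAB : dist A B = ρ + R) (hAK : dist A K = ρ + r) (hBK : R + r ≤ dist B K) :
    ∀ t : ℝ, 0 ≤ t → r < dist K (A + t • (B - A)) := by
  intro t ht
  have hu : ‖B - A‖ = ρ + R := by rw [← dist_eq_norm, dist_comm, hAB]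
  have hv : ‖K - A‖ = ρ + r := by rw [← dist_eq_norm, dist_comm, hAK]
  have hw : R + r ≤ ‖(K - A) - (B - A)‖ := by
    rwa [sub_sub_sub_cancel_right, ← dist_eq_norm, dist_comm]
  have hinner : inner ℝ (K - A) (B - A) ≤ (ρ + R) * ρ := by
    have hsq := norm_sub_sq_real (K - A) (B - A)
    rw [hu, hv] at hsq
    have hle : (R + r) ^ 2 ≤ ‖(K - A) - (B - A)‖ ^ 2 := by gcongr
    nlinarith [mul_nonneg hr.le (sub_nonneg.2 hRρ)]
  have hexpand : ‖(K - A) - t • (B - A)‖ ^ 2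
      = (ρ + r) ^ 2 - 2 * (t * inner ℝ (K - A) (B - A)) + (t * (ρ + R)) ^ 2 := by
    rw [norm_sub_sq_real, inner_smul_right, norm_smul, hu, hv, Real.norm_of_nonneg ht]
  rw [dist_eq_norm, ← sub_sub]
  refine lt_of_pow_lt_pow_left₀ 2 (norm_nonneg _) ?_
  rw [hexpand]
  nlinarith [mul_le_mul_of_nonneg_left hinner ht, sq_nonneg (t * (ρ + R) - ρ), mul_pos hρ hr]
end

section
/- Let A = {α₁, α₂, α₃, α₄, α₅} be a 1-equilateral set of five distinct points in the Petty space with α₅ = (0,0,0) and α₄ = (0, d, 1 − d) where d > 0, and suppose the z-coordinates zᵢ of α₁, α₂, α₃ satisfy 0 ≤ zᵢ ≤ 1 − d for i = 1,2,3. Then necessarily d < 1/4, and writing αᵢ = (xᵢ, yᵢ, zᵢ) for i = 1,2,3, each of these points lies on the ellipse given by zᵢ = −(d/(d+1))·yᵢ + 1/(2(1+d)) and xᵢ² = ((2d+1)/(4(d+1)²))·(−4yᵢ² + 4d·yᵢ + 2d + 1); moreover 1/2 − d ≤ zᵢ ≤ 1/2 for i = 1,2,3. -/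
/-- The squared Euclidean part of two points at unit Petty distance. -/
theorem sq_add_sq_of_pettyDist_eq_one {a b : ℝ × ℝ × ℝ} (h : pettyDist a b = 1) :
    (a.1 - b.1) ^ 2 + (a.2.1 - b.2.1) ^ 2 = (1 - |a.2.2 - b.2.2|) ^ 2 := by
  simp only [pettyDist, pettyNorm, Prod.fst_sub, Prod.snd_sub] at h
  rw [← Real.sq_sqrt (add_nonneg (sq_nonneg (a.1 - b.1)) (sq_nonneg (a.2.1 - b.2.1)))]
  congr 1
  linarith

/-- A point at unit Petty distance from both `(0, 0, 0)` and `(0, d, 1 - d)`, with height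
between theirs, lies on an ellipse. -/
theorem mem_ellipse_of_pettyDist {d : ℝ} (hd : 0 < d) {a : ℝ × ℝ × ℝ}
    (h0 : pettyDist a (0, 0, 0) = 1) (h1 : pettyDist a (0, d, 1 - d) = 1)
    (hz0 : 0 ≤ a.2.2) (hz1 : a.2.2 ≤ 1 - d) :
    a.2.2 = -(d / (d + 1)) * a.2.1 + 1 / (2 * (1 + d)) ∧
    a.1 ^ 2 = (2 * d + 1) / (4 * (d + 1) ^ 2) *
      (-4 * a.2.1 ^ 2 + 4 * d * a.2.1 + 2 * d + 1) ∧
    1/2 - d ≤ a.2.2 ∧ a.2.2 ≤ 1/2 := by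
  obtain ⟨x, y, z⟩ := a
  have e0 := sq_add_sq_of_pettyDist_eq_one h0
  have e1 := sq_add_sq_of_pettyDist_eq_one h1
  simp only at e0 e1 hz0 hz1 ⊢
  rw [abs_of_nonneg (by linarith)] at e0
  rw [abs_of_nonpos (by linarith)] at e1
  have hlin : 2 * (d + 1) * z = 1 - 2 * d * y := by linear_combination e0 - e1
  have hzy : z = -(d / (d + 1)) * y + 1 / (2 * (1 + d)) := by
    field_simp
    linear_combination (1 + d) * hlin
  have hx : x ^ 2 = (2 * d + 1) / (4 * (d + 1) ^ 2) *
      (-4 * y ^ 2 + 4 * d * y + 2 * d + 1) := by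
    have hx' : x ^ 2 = (1 - z) ^ 2 - y ^ 2 := by linear_combination e0
    rw [hx', hzy]
    field_simp
    ring
  have hy : (2 * y - d) ^ 2 ≤ (d + 1) ^ 2 := by
    have hpos : 0 < (2 * d + 1) / (4 * (d + 1) ^ 2) := by positivity
    have := nonneg_of_mul_nonneg_right (hx ▸ sq_nonneg x) hpos
    linarith
  obtain ⟨hy1, hy2⟩ := abs_le_of_sq_le_sq' hy (by linarith)
  refine ⟨hzy, hx, ?_, ?_⟩ <;> nlinarith

/-- Three unit vectors `(sᵢ, cᵢ)` whose inner products are given in terms of the gaps between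
their sorted second coordinates, the upper gap being at least the lower one, do not exist
once `d ≥ 1/4`. -/
theorem false_of_unit_vectors_of_gap_le {d s₁ c₁ s₂ c₂ s₃ c₃ : ℝ} (hd : 1 / 4 ≤ d)
    (h₁ : s₁ ^ 2 + c₁ ^ 2 = 1) (h₂ : s₂ ^ 2 + c₂ ^ 2 = 1) (h₃ : s₃ ^ 2 + c₃ ^ 2 = 1)
    (h₁₂ : (2 * d + 1) * (s₁ * s₂ + c₁ * c₂) = 2 * d - 1 + 2 * d * (c₂ - c₁))
    (h₂₃ : (2 * d + 1) * (s₂ * s₃ + c₂ * c₃) = 2 * d - 1 + 2 * d * (c₃ - c₂))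
    (h₁₃ : (2 * d + 1) * (s₁ * s₃ + c₁ * c₃) = 2 * d - 1 + 2 * d * (c₃ - c₁))
    (hc : c₁ ≤ c₂) (hgap : c₂ - c₁ ≤ c₃ - c₂) : False := by
  have hE : 0 < 2 * d + 1 := by linarith
  obtain ⟨X, hX⟩ : ∃ X, X = s₁ * s₂ + c₁ * c₂ := ⟨_, rfl⟩
  obtain ⟨Y, hY⟩ : ∃ Y, Y = s₂ * s₃ + c₂ * c₃ := ⟨_, rfl⟩
  obtain ⟨Z, hZ⟩ : ∃ Z, Z = s₁ * s₃ + c₁ * c₃ := ⟨_, rfl⟩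
  rw [← hX] at h₁₂
  rw [← hY] at h₂₃
  rw [← hZ] at h₁₃
  have gram : 1 + 2 * X * Y * Z - X ^ 2 - Y ^ 2 - Z ^ 2 = 0 := by
    have hdet : (s₁ ^ 2 + c₁ ^ 2) * (s₂ ^ 2 + c₂ ^ 2) * (s₃ ^ 2 + c₃ ^ 2) + 2 * X * Y * Z
        - (s₃ ^ 2 + c₃ ^ 2) * X ^ 2 - (s₁ ^ 2 + c₁ ^ 2) * Y ^ 2
        - (s₂ ^ 2 + c₂ ^ 2) * Z ^ 2 = 0 := by
      rw [hX, hY, hZ]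
      ring
    rw [h₁, h₂, h₃] at hdet
    linear_combination hdet
  have hXlow : -1 / 3 ≤ X := by
    refine le_of_mul_le_mul_left ?_ hE
    linarith [mul_nonneg (by linarith : (0 : ℝ) ≤ 2 * d) (sub_nonneg.2 hc)]
  have hXY : X ≤ Y := by
    refine le_of_mul_le_mul_left ?_ hE
    have := mul_le_mul_of_nonneg_left hgap (by linarith : (0 : ℝ) ≤ 2 * d)
    linarith
  have hYZ : Y ≤ Z := by
    refine le_of_mul_le_mul_left ?_ hE
    have := mul_nonneg (by linarith : (0 : ℝ) ≤ 2 * d) (sub_nonneg.2 hc)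
    linarith
  have hdist : 2 - 2 * X = (s₁ - s₂) ^ 2 + (c₁ - c₂) ^ 2 := by
    linear_combination - h₁ - h₂ - 2 * hX
  have hX1 : X < 1 := by
    by_contra! hcon
    have hcc : c₁ - c₂ = 0 := by
      have : (c₁ - c₂) ^ 2 = 0 := le_antisymm (by linarith [sq_nonneg (s₁ - s₂)]) (sq_nonneg _)
      exact pow_eq_zero_iff (two_ne_zero) |>.1 this
    have : c₂ - c₁ = 0 := by linarith
    rw [this] at h₁₂
    linarith [mul_le_mul_of_nonneg_left hcon hE.le]
  have hY1 : Y ≤ 1 := by linarith [sq_nonneg (s₂ - s₃), sq_nonneg (c₂ - c₃)]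
  have hZ1 : Z ≤ 1 := by linarith [sq_nonneg (s₁ - s₃), sq_nonneg (c₁ - c₃)]
  have hZlow : 1 / 3 ≤ Z := by
    by_contra! hcon
    have a1 : X ^ 2 ≤ (1 / 3) ^ 2 := sq_le_sq' (by linarith) (by linarith)
    have a2 : Y ^ 2 ≤ (1 / 3) ^ 2 := sq_le_sq' (by linarith) (by linarith)
    have a3 : Z ^ 2 ≤ (1 / 3) ^ 2 := sq_le_sq' (by linarith) (by linarith)
    have a4 : (X * Y) ^ 2 ≤ (1 / 3) ^ 2 * (1 / 3) ^ 2 := by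
      rw [mul_pow]
      exact mul_le_mul a1 a2 (sq_nonneg Y) (by norm_num)
    linarith [sq_nonneg (X * Y + Z)]
  have hpos : 0 ≤ Y + Z - 2 * X * Z := by
    rcases le_total 0 X with h | h
    · linarith [mul_nonneg h (sub_nonneg.2 hZ1),
        mul_nonneg (by linarith : 0 ≤ Z) (sub_nonneg.2 hX1.le)]
    · linarith [mul_nonneg (neg_nonneg.2 h) (by linarith : 0 ≤ Z)]
  have hkey : (Y + Z - X - 1) ^ 2 ≤ (Z - X) ^ 2 * (2 + 2 * X) := by
    have hid : (Z - X) ^ 2 * (2 + 2 * X) - (Y + Z - X - 1) ^ 2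
        = 2 * (1 + X) * (1 - Y) * (Y + Z - 2 * X * Z) := by
      linear_combination (-(1 + 2 * X)) * gram
    have : 0 ≤ 2 * (1 + X) * (1 - Y) * (Y + Z - 2 * X * Z) :=
      mul_nonneg (mul_nonneg (by linarith) (by linarith)) hpos
    linarith
  have hbound : (c₃ - c₂) ^ 2 * (2 + 2 * X) ≤ (Y + Z - X - 1) ^ 2 := by
    have hw : 2 + 2 * X = (s₁ + s₂) ^ 2 + (c₁ + c₂) ^ 2 := by
      linear_combination - h₁ - h₂ + 2 * hX
    have hexp : (c₃ - c₂) * ((2 + 2 * X) * (2 - 2 * X)) =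
        (Z - X - Y + 1) * (c₁ - c₂) * (2 + 2 * X)
          + (Y + Z - X - 1) * (c₁ + c₂) * (2 - 2 * X) := by
      rw [hw, hdist, hX, hY, hZ]
      have hA : s₁ * s₃ + c₁ * c₃ - (s₁ * s₂ + c₁ * c₂) - (s₂ * s₃ + c₂ * c₃) + 1 =
          (s₃ - s₂) * (s₁ - s₂) + (c₃ - c₂) * (c₁ - c₂) := by linear_combination -h₂
      have hB : s₂ * s₃ + c₂ * c₃ + (s₁ * s₃ + c₁ * c₃) - (s₁ * s₂ + c₁ * c₂) - 1 =
          (s₃ - s₂) * (s₁ + s₂) + (c₃ - c₂) * (c₁ + c₂) := by linear_combination h₂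
      rw [hA, hB]
      have horth : (s₁ - s₂) * (s₁ + s₂) + (c₁ - c₂) * (c₁ + c₂) = 0 := by
        linear_combination h₁ - h₂
      linear_combination ((c₃ - c₂) * ((s₁ - s₂) * (s₁ + s₂) + (c₁ - c₂) * (c₁ + c₂))
        - (c₁ - c₂) * ((s₃ - s₂) * (s₁ + s₂) + (c₃ - c₂) * (c₁ + c₂))
        - (c₁ + c₂) * ((s₃ - s₂) * (s₁ - s₂) + (c₃ - c₂) * (c₁ - c₂))) * horth
    have hle : (c₃ - c₂) * (2 + 2 * X) ≤ (Y + Z - X - 1) * (c₁ + c₂) := by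
      refine le_of_mul_le_mul_right ?_ (by linarith : 0 < 2 - 2 * X)
      have := mul_nonneg (mul_nonneg (by linarith : 0 ≤ Z - X - Y + 1) (sub_nonneg.2 hc))
        (by linarith : 0 ≤ 2 + 2 * X)
      linarith
    have hsq := pow_le_pow_left₀ (mul_nonneg (by linarith) (by linarith)) hle 2
    refine le_of_mul_le_mul_right ?_ (by linarith : 0 < 2 + 2 * X)
    have hcs : (c₁ + c₂) ^ 2 ≤ 2 + 2 * X := by rw [hw]; linarith [sq_nonneg (s₁ + s₂)]
    have := mul_le_mul_of_nonneg_left hcs (sq_nonneg (Y + Z - X - 1))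
    linarith
  have hZX : (2 * d + 1) * (Z - X) = 2 * d * (c₃ - c₂) := by linear_combination h₁₃ - h₁₂
  have hle : (c₃ - c₂) ^ 2 ≤ (Z - X) ^ 2 :=
    le_of_mul_le_mul_right (hbound.trans hkey) (by linarith)
  have hZX0 : Z - X = 0 := by
    have h1 : c₃ - c₂ ≤ Z - X := by
      exact (sq_le_sq₀ (by linarith) (by linarith)).1 hle
    linarith [mul_nonneg (by linarith : 0 ≤ d) (sub_nonneg.2 h1)]
  have hYX : Y = X := by linarith
  have hZeq : Z = X := by linarith
  rw [hYX, hZeq] at gram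
  have : (1 - X) ^ 2 * (1 + 2 * X) = 0 := by linear_combination gram
  have : 0 < (1 - X) ^ 2 * (1 + 2 * X) :=
    mul_pos (pow_pos (by linarith) 2) (by linarith)
  linarith

theorem false_of_unit_vectors_of_sorted {d s₁ c₁ s₂ c₂ s₃ c₃ : ℝ} (hd : 1 / 4 ≤ d)
    (h₁ : s₁ ^ 2 + c₁ ^ 2 = 1) (h₂ : s₂ ^ 2 + c₂ ^ 2 = 1) (h₃ : s₃ ^ 2 + c₃ ^ 2 = 1)
    (h₁₂ : (2 * d + 1) * (s₁ * s₂ + c₁ * c₂) = 2 * d - 1 + 2 * d * |c₁ - c₂|)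
    (h₂₃ : (2 * d + 1) * (s₂ * s₃ + c₂ * c₃) = 2 * d - 1 + 2 * d * |c₂ - c₃|)
    (h₁₃ : (2 * d + 1) * (s₁ * s₃ + c₁ * c₃) = 2 * d - 1 + 2 * d * |c₁ - c₃|)
    (hc : c₁ ≤ c₂) (hc' : c₂ ≤ c₃) : False := by
  rw [abs_of_nonpos (by linarith)] at h₁₂ h₂₃ h₁₃
  rcases le_total (c₂ - c₁) (c₃ - c₂) with h | h
  · exact false_of_unit_vectors_of_gap_le hd h₁ h₂ h₃ (by linarith) (by linarith)
      (by linarith) hc h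
  · exact false_of_unit_vectors_of_gap_le (s₁ := s₃) (c₁ := -c₃) (s₂ := s₂) (c₂ := -c₂)
      (s₃ := s₁) (c₃ := -c₁) hd
      (by linarith) (by linarith) (by linarith)
      (by linear_combination h₂₃) (by linear_combination h₁₂) (by linear_combination h₁₃)
      (by linarith) (by linarith)

/-- Three unit vectors `u i = (s i, c i)` with inner products prescribed by
`(2d + 1) ⟪u i, u j⟫ = 2d - 1 + 2d |c i - c j|` exist only for `d < 1/4`. -/
theorem lt_quarter_of_unit_vectors {d : ℝ} {s c : Fin 3 → ℝ}
    (h : ∀ i, s i ^ 2 + c i ^ 2 = 1)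
    (hij : ∀ i j, i ≠ j →
      (2 * d + 1) * (s i * s j + c i * c j) = 2 * d - 1 + 2 * d * |c i - c j|) :
    d < 1 / 4 := by
  by_contra! hd
  have key : ∀ i j k : Fin 3, i ≠ j → j ≠ k → i ≠ k → c i ≤ c j → c j ≤ c k → False :=
    fun i j k h₁₂ h₂₃ h₁₃ => false_of_unit_vectors_of_sorted hd (h i) (h j) (h k)
      (hij i j h₁₂) (hij j k h₂₃) (hij i k h₁₃)
  rcases le_total (c 0) (c 1) with h01 | h01 <;> rcases le_total (c 1) (c 2) with h12 | h12 <;>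
    rcases le_total (c 0) (c 2) with h02 | h02
  · exact key 0 1 2 (by decide) (by decide) (by decide) h01 h12
  · exact key 0 1 2 (by decide) (by decide) (by decide) h01 h12
  · exact key 0 2 1 (by decide) (by decide) (by decide) h02 h12
  · exact key 2 0 1 (by decide) (by decide) (by decide) h02 h01
  · exact key 1 0 2 (by decide) (by decide) (by decide) h01 h02
  · exact key 1 2 0 (by decide) (by decide) (by decide) h12 h02
  · exact key 2 1 0 (by decide) (by decide) (by decide) h12 h01
  · exact key 2 1 0 (by decide) (by decide) (by decide) h12 h01

/-- for a five-point 1-equilateral set in the Petty space with α₅ = (0,0,0),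
α₄ = (0,d,1−d), d > 0 and the other three points with z-coordinates in [0, 1−d], we must
have d < 1/4, the three points lie on the stated ellipse, and 1/2 − d ≤ zᵢ ≤ 1/2. -/
theorem equilateral_five_on_ellipse (d : ℝ) (hd : 0 < d) (α : Fin 5 → ℝ × ℝ × ℝ)
    (hequi : ∀ i j, i ≠ j → pettyDist (α i) (α j) = 1)
    (h5 : α 4 = (0, 0, 0)) (h4 : α 3 = (0, d, 1 - d))
    (hz : ∀ i : Fin 5, i.val < 3 → 0 ≤ (α i).2.2 ∧ (α i).2.2 ≤ 1 - d) :
    d < 1/4 ∧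
    ∀ i : Fin 5, i.val < 3 →
      (α i).2.2 = -(d / (d + 1)) * (α i).2.1 + 1 / (2 * (1 + d)) ∧
      (α i).1 ^ 2 = (2 * d + 1) / (4 * (d + 1) ^ 2) *
        (-4 * (α i).2.1 ^ 2 + 4 * d * (α i).2.1 + 2 * d + 1) ∧
      1/2 - d ≤ (α i).2.2 ∧ (α i).2.2 ≤ 1/2 := by
  have hell : ∀ i : Fin 5, i.val < 3 → _ := fun i hi =>
    mem_ellipse_of_pettyDist hd (a := α i)
      (h5 ▸ hequi i 4 (by rintro rfl; simp at hi))
      (h4 ▸ hequi i 3 (by rintro rfl; simp at hi)) (hz i hi).1 (hz i hi).2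
  refine ⟨?_, hell⟩
  have hE : 0 < 2 * d + 1 := by linarith
  let f : Fin 3 → Fin 5 := Fin.castLE (by norm_num)
  have hf : Function.Injective f := Fin.castLE_injective _
  have hf3 : ∀ i, (f i).val < 3 := fun i => i.isLt
  have hr : √(2 * d + 1) ^ 2 = 2 * d + 1 := Real.sq_sqrt hE.le
  have hr0 : √(2 * d + 1) ≠ 0 := (Real.sqrt_pos.2 hE).ne'
  have hd1 : d + 1 ≠ 0 := by linarith
  refine lt_quarter_of_unit_vectors (s := fun i => 2 * (α (f i)).1 / √(2 * d + 1))
    (c := fun i => (2 * (α (f i)).2.1 - d) / (d + 1)) (fun i => ?_) (fun i j hij => ?_)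
  · have hx := (hell (f i) (hf3 i)).2.1
    rw [div_pow, hr, mul_pow, hx]
    field_simp
    ring
  · have hxi := (hell (f i) (hf3 i)).2.1
    have hxj := (hell (f j) (hf3 j)).2.1
    have hzi := (hell (f i) (hf3 i)).1
    have hzj := (hell (f j) (hf3 j)).1
    have hD := sq_add_sq_of_pettyDist_eq_one (hequi (f i) (f j) (hf.ne hij))
    generalize α (f i) = a at *
    generalize α (f j) = b at *
    obtain ⟨x, y, z⟩ := a
    obtain ⟨x', y', z'⟩ := b
    simp only at *
    have hcc : (2 * y - d) / (d + 1) - (2 * y' - d) / (d + 1) = 2 * (y - y') / (d + 1) := by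
      ring
    have hΔz : z - z' = -(d / (d + 1)) * (y - y') := by rw [hzi, hzj]; ring
    have hss : (2 * d + 1) * (2 * x / √(2 * d + 1) * (2 * x' / √(2 * d + 1))) = 4 * (x * x') := by
      rw [div_mul_div_comm, ← sq, hr]
      field_simp
      ring
    have habs : |z - z'| = d / (d + 1) * |y - y'| := by
      rw [hΔz, abs_mul, abs_neg, abs_of_pos (by positivity)]
    have habs' : |2 * (y - y') / (d + 1)| = 2 / (d + 1) * |y - y'| := by
      rw [mul_div_right_comm, abs_mul, abs_of_pos (by positivity)]
    rw [mul_add, hss, hcc, habs']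
    rw [habs] at hD
    have hsq := sq_abs (y - y')
    generalize |y - y'| = t at *
    have hxx : 4 * (x * x') =
        2 * (x ^ 2 + x' ^ 2 + (y - y') ^ 2 - (1 - d / (d + 1) * t) ^ 2) := by
      linear_combination -2 * hD
    rw [hxx, hxi, hxj]
    field_simp
    linear_combination (-8 * d ^ 2) * hsq
end

section
/- Let A = {α₁, α₂, α₃, α₄, α₅} be a 1-equilateral set of five distinct points in the Petty space with α₅ = (0,0,0) and α₄ = (0, d, 1 − d) where 0 < d < 1/4, and suppose the z-coordinates α′ᵢ of the points satisfy α′₅ ≤ α′₃ ≤ α′₂ ≤ α′₁ ≤ α′₄. Then A has no center: there is no point c ∈ ℝ³ and no r > 0 such that ‖c − αᵢ‖ = r for all i = 1, …, 5. -/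
theorem planar_sq_of_pettyDist_eq {a b : ℝ × ℝ × ℝ} {r : ℝ} (h : pettyDist a b = r) :
    (a.1 - b.1) ^ 2 + (a.2.1 - b.2.1) ^ 2 = (r - |a.2.2 - b.2.2|) ^ 2 := by
  simp only [pettyDist, pettyNorm, Prod.fst_sub, Prod.snd_sub] at h
  rw [← h, add_sub_cancel_right, Real.sq_sqrt (by positivity)]

/-- The planar sections of two distance conditions with common focus at the origin are confocal
hyperbola branches; if these are independent, they meet in at most two points. -/
theorem confocal_eq_or_eq {a₁ a₂ k b₁ b₂ l : ℝ}
    (hind : a₁ * l ≠ b₁ * k ∨ a₂ * l ≠ b₂ * k)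
    {x y s x' y' s' u v t : ℝ}
    (hx : x ^ 2 + y ^ 2 = s ^ 2) (hxa : (x - a₁) ^ 2 + (y - a₂) ^ 2 = (s + k) ^ 2)
    (hxb : (x - b₁) ^ 2 + (y - b₂) ^ 2 = (s + l) ^ 2)
    (hx' : x' ^ 2 + y' ^ 2 = s' ^ 2) (hxa' : (x' - a₁) ^ 2 + (y' - a₂) ^ 2 = (s' + k) ^ 2)
    (hxb' : (x' - b₁) ^ 2 + (y' - b₂) ^ 2 = (s' + l) ^ 2)
    (hu : u ^ 2 + v ^ 2 = t ^ 2) (hua : (u - a₁) ^ 2 + (v - a₂) ^ 2 = (t + k) ^ 2)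
    (hub : (u - b₁) ^ 2 + (v - b₂) ^ 2 = (t + l) ^ 2)
    (hne : (x' - x) ^ 2 + (y' - y) ^ 2 ≠ (s' - s) ^ 2) :
    (u = x ∧ v = y ∧ t = s) ∨ (u = x' ∧ v = y' ∧ t = s') := by
  have ea : a₁ * (x' - x) + a₂ * (y' - y) + k * (s' - s) = 0 := by linarith
  have eb : b₁ * (x' - x) + b₂ * (y' - y) + l * (s' - s) = 0 := by linarith
  have fa : a₁ * (u - x) + a₂ * (v - y) + k * (t - s) = 0 := by linarith
  have fb : b₁ * (u - x) + b₂ * (v - y) + l * (t - s) = 0 := by linarith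
  have hq : (x' - x) * x + (y' - y) * y - (s' - s) * s =
      -((x' - x) ^ 2 + (y' - y) ^ 2 - (s' - s) ^ 2) / 2 := by linarith
  have hf : 2 * ((u - x) * x + (v - y) * y - (t - s) * s) +
      ((u - x) ^ 2 + (v - y) ^ 2 - (t - s) ^ 2) = 0 := by linarith
  have hN : 0 < (a₂ * l - b₂ * k) ^ 2 + (b₁ * k - a₁ * l) ^ 2 + (a₁ * b₂ - a₂ * b₁) ^ 2 := by
    rcases hind with h | h
    · have := sq_pos_of_ne_zero (sub_ne_zero.2 h.symm); positivity
    · have := sq_pos_of_ne_zero (sub_ne_zero.2 h); positivity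
  obtain ⟨n₁, h₁⟩ : ∃ n, n = a₂ * l - b₂ * k := ⟨_, rfl⟩
  obtain ⟨n₂, h₂⟩ : ∃ n, n = b₁ * k - a₁ * l := ⟨_, rfl⟩
  obtain ⟨n₃, h₃⟩ : ∃ n, n = a₁ * b₂ - a₂ * b₁ := ⟨_, rfl⟩
  rw [← h₁, ← h₂, ← h₃] at hN
  have key : ∀ p q w : ℝ, a₁ * p + a₂ * q + k * w = 0 → b₁ * p + b₂ * q + l * w = 0 →
      ∃ m, p = m * n₁ ∧ q = m * n₂ ∧ w = m * n₃ := by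
    intro p q w ha hb
    have c₁ : q * n₃ = w * n₂ := by
      subst h₂ h₃; linear_combination a₁ * hb - b₁ * ha
    have c₂ : w * n₁ = p * n₃ := by
      subst h₁ h₃; linear_combination a₂ * hb - b₂ * ha
    have c₃ : p * n₂ = q * n₁ := by
      subst h₁ h₂; linear_combination k * hb - l * ha
    refine ⟨(p * n₁ + q * n₂ + w * n₃) / (n₁ ^ 2 + n₂ ^ 2 + n₃ ^ 2), ?_, ?_, ?_⟩ <;>
      rw [div_mul_eq_mul_div, eq_div_iff hN.ne']
    · linear_combination n₂ * c₃ - n₃ * c₂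
    · linear_combination n₃ * c₁ - n₁ * c₃
    · linear_combination n₁ * c₂ - n₂ * c₁
  obtain ⟨m, em₁, em₂, em₃⟩ := key _ _ _ ea eb
  obtain ⟨m', fm₁, fm₂, fm₃⟩ := key _ _ _ fa fb
  rw [em₁, em₂, em₃] at hq hne
  rw [fm₁, fm₂, fm₃] at hf
  have hQ : m * (n₁ ^ 2 + n₂ ^ 2 - n₃ ^ 2) ≠ 0 := by
    intro h; apply hne; linear_combination m * h
  have hm : m ≠ 0 := left_ne_zero_of_mul hQ
  have hprod : m' * (m' - m) * (m * (n₁ ^ 2 + n₂ ^ 2 - n₃ ^ 2)) = 0 := by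
    linear_combination m * hf - 2 * m' * hq
  rcases mul_eq_zero.1 ((mul_eq_zero.1 hprod).resolve_right hQ) with h | h
  · rw [h] at fm₁ fm₂ fm₃
    exact Or.inl ⟨by linarith, by linarith, by linarith⟩
  · rw [sub_eq_zero.1 h] at fm₁ fm₂ fm₃
    exact Or.inr ⟨by linarith, by linarith, by linarith⟩

/-- Planar form of the bounds on the height `k` of a point at Petty distance `1` from both
`(0, 0, 0)` and `(0, d, 1 - d)`. -/
theorem height_bounds {d x y k : ℝ} (hd : 0 < d) (hk : k ≤ 1 - d)
    (h : x ^ 2 + y ^ 2 = (1 - k) ^ 2) (h' : x ^ 2 + (y - d) ^ 2 = (d + k) ^ 2) :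
    1 / 2 - d ≤ k ∧ k ≤ 1 / 2 := by
  have hy : 2 * d * y = 1 - 2 * k * (1 + d) := by linarith
  have hle : |y| ≤ 1 - k := abs_le_of_sq_le_sq (by nlinarith [sq_nonneg x]) (by linarith)
  obtain ⟨h₁, h₂⟩ := abs_le.1 hle
  exact ⟨by nlinarith, by nlinarith⟩

/-- The horizontal position of a point at the least admissible height `1 / 2 - d` is determined. -/
theorem eq_of_height_eq_half_sub {d x y x' y' : ℝ} (hd : 0 < d)
    (h : x ^ 2 + y ^ 2 = (1 - (1 / 2 - d)) ^ 2)
    (h' : x ^ 2 + (y - d) ^ 2 = (d + (1 / 2 - d)) ^ 2)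
    (g : x' ^ 2 + y' ^ 2 = (1 - (1 / 2 - d)) ^ 2)
    (g' : x' ^ 2 + (y' - d) ^ 2 = (d + (1 / 2 - d)) ^ 2) : x = x' ∧ y = y' := by
  have key : ∀ x y : ℝ, x ^ 2 + y ^ 2 = (1 - (1 / 2 - d)) ^ 2 →
      x ^ 2 + (y - d) ^ 2 = (d + (1 / 2 - d)) ^ 2 → x = 0 ∧ y = 1 / 2 + d := by
    intro x y h h'
    have hy : y = 1 / 2 + d := by
      apply mul_left_cancel₀ hd.ne'; linarith
    subst hy
    exact ⟨pow_eq_zero_iff two_ne_zero |>.1 (by linarith), rfl⟩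
  obtain ⟨h₁, h₂⟩ := key x y h h'
  obtain ⟨g₁, g₂⟩ := key x' y' g g'
  exact ⟨h₁.trans g₁.symm, h₂.trans g₂.symm⟩

/-- No center lies at or above the middle one of the three intermediate heights. -/
theorem no_center_of_le {d : ℝ} (hd₀ : 0 < d) (hd₁ : d < 1 / 2)
    {a b c q : ℝ × ℝ × ℝ} {r : ℝ}
    (ha : pettyDist a (0, 0, 0) = 1) (hb : pettyDist b (0, 0, 0) = 1)
    (hc : pettyDist c (0, 0, 0) = 1)
    (ha' : pettyDist a (0, d, 1 - d) = 1) (hb' : pettyDist b (0, d, 1 - d) = 1)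
    (hc' : pettyDist c (0, d, 1 - d) = 1)
    (hab : pettyDist a b = 1) (hac : pettyDist c a = 1) (hbc : pettyDist c b = 1)
    (h0a : 0 ≤ a.2.2) (hkab : a.2.2 ≤ b.2.2) (hkbc : b.2.2 ≤ c.2.2) (hcd : c.2.2 ≤ 1 - d)
    (hq : pettyDist q (0, 0, 0) = r) (hq' : pettyDist q (0, d, 1 - d) = r)
    (hqa : pettyDist q a = r) (hqb : pettyDist q b = r) (hqc : pettyDist q c = r)
    (hbq : b.2.2 ≤ q.2.2) : False := by
  obtain ⟨a₁, a₂, k⟩ := a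
  obtain ⟨b₁, b₂, l⟩ := b
  obtain ⟨c₁, c₂, m⟩ := c
  obtain ⟨q₁, q₂, w⟩ := q
  have ea := planar_sq_of_pettyDist_eq ha
  have eb := planar_sq_of_pettyDist_eq hb
  have ec := planar_sq_of_pettyDist_eq hc
  have ea' := planar_sq_of_pettyDist_eq ha'
  have eb' := planar_sq_of_pettyDist_eq hb'
  have ec' := planar_sq_of_pettyDist_eq hc'
  have eab := planar_sq_of_pettyDist_eq hab
  have eac := planar_sq_of_pettyDist_eq hac
  have ebc := planar_sq_of_pettyDist_eq hbc
  have eq := planar_sq_of_pettyDist_eq hq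
  have eqa := planar_sq_of_pettyDist_eq hqa
  have eqb := planar_sq_of_pettyDist_eq hqb
  dsimp only at *
  rw [sub_zero, sub_zero, sub_zero, abs_of_nonneg (by linarith)] at ea eb ec eq
  rw [sub_zero, abs_of_nonpos (by linarith), show ∀ t : ℝ, 1 - -(t - (1 - d)) = d + t by
    intro t; ring] at ea' eb' ec'
  rw [abs_of_nonpos (by linarith)] at eab
  rw [abs_of_nonneg (by linarith)] at eac ebc eqa eqb
  obtain ⟨hk₁, -⟩ := height_bounds hd₀ (by linarith) ea ea'
  obtain ⟨-, hm⟩ := height_bounds hd₀ hcd ec ec'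
  have hne : k = l → ¬ (a₁ = b₁ ∧ a₂ = b₂) := by
    rintro rfl ⟨rfl, rfl⟩
    norm_num at eab
  have hl : 1 / 2 - d < l := by
    rcases (hk₁.trans hkab).lt_or_eq with h | h
    · exact h
    · have hk : k = 1 / 2 - d := by linarith
      subst hk h
      exact absurd (eq_of_height_eq_half_sub hd₀ ea ea' eb eb') (hne rfl)
  have hind : a₁ * l ≠ b₁ * k ∨ a₂ * l ≠ b₂ * k := by
    by_contra! h
    have h2 : ((1 - k) * l) ^ 2 = ((1 - l) * k) ^ 2 := by
      linear_combination -l ^ 2 * ea + k ^ 2 * eb + (a₁ * l + b₁ * k) * h.1 +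
        (a₂ * l + b₂ * k) * h.2
    have h3 := (sq_eq_sq₀ (mul_nonneg (by linarith) (by linarith))
      (mul_nonneg (by linarith) (by linarith))).1 h2
    have hkl : k = l := by linarith
    subst hkl
    have hk0 : k ≠ 0 := by linarith
    exact hne rfl ⟨mul_right_cancel₀ hk0 h.1, mul_right_cancel₀ hk0 h.2⟩
  have hcases := confocal_eq_or_eq (x := 0) (y := d) (s := d) (x' := c₁) (y' := c₂)
    (s' := 1 - m) (u := q₁) (v := q₂) (t := r - w) hind (by ring) (by linarith) (by linarith)
    ec (by linarith) (by linarith) eq (by linarith) (by linarith)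
    (by
      intro h
      have : 2 * (d + m) = 1 := by linarith
      linarith)
  rcases hcases with ⟨rfl, rfl, hr⟩ | ⟨rfl, rfl, hr⟩
  · have : |w - (1 - q₂)| = r := by
      simpa [pettyDist, pettyNorm] using hq'
    rcases abs_cases (w - (1 - q₂)) with h | h <;> linarith
  · have : |w - m| = r := by
      simpa [pettyDist, pettyNorm] using hqc
    rcases abs_cases (w - m) with h | h <;> linarith

theorem pettyDist_reflect (s t : ℝ) (a b : ℝ × ℝ × ℝ) :
    pettyDist (a.1, s - a.2.1, t - a.2.2) (b.1, s - b.2.1, t - b.2.2) = pettyDist a b := by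
  simp only [pettyDist, pettyNorm, Prod.fst_sub, Prod.snd_sub, sub_sub_sub_cancel_left]
  rw [abs_sub_comm, sub_sq_comm a.2.1]

/-- a five-point 1-equilateral set in the Petty space with α₅ = (0,0,0),
α₄ = (0,d,1−d), 0 < d < 1/4 and z-coordinates ordered α′₅ ≤ α′₃ ≤ α′₂ ≤ α′₁ ≤ α′₄
has no center. -/
theorem equilateral_five_no_center (d : ℝ) (hd₀ : 0 < d) (hd₁ : d < 1/4)
    (α : Fin 5 → ℝ × ℝ × ℝ)
    (hequi : ∀ i j, i ≠ j → pettyDist (α i) (α j) = 1)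
    (h5 : α 4 = (0, 0, 0)) (h4 : α 3 = (0, d, 1 - d))
    (horder : (α 4).2.2 ≤ (α 2).2.2 ∧ (α 2).2.2 ≤ (α 1).2.2 ∧
      (α 1).2.2 ≤ (α 0).2.2 ∧ (α 0).2.2 ≤ (α 3).2.2) :
    ¬ ∃ (c : ℝ × ℝ × ℝ) (r : ℝ), 0 < r ∧ ∀ i, pettyDist c (α i) = r := by
  rintro ⟨q, r, -, hq⟩
  obtain ⟨h₁, h₂, h₃, h₄⟩ := horder
  rw [h5] at h₁
  rw [h4] at h₄
  dsimp only at h₁ h₄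
  rcases le_total (α 1).2.2 q.2.2 with h | h
  · refine no_center_of_le hd₀ (by linarith) (a := α 2) (b := α 1) (c := α 0) (q := q) (r := r)
      ?_ ?_ ?_ ?_ ?_ ?_ ?_ ?_ ?_ h₁ h₂ h₃ h₄ ?_ ?_ ?_ ?_ ?_ h <;>
      first
        | rw [← h5]
        | rw [← h4]
        | skip
    all_goals first | exact hq _ | exact hequi _ _ (by decide)
  · let σ : ℝ × ℝ × ℝ → ℝ × ℝ × ℝ := fun a => (a.1, d - a.2.1, 1 - d - a.2.2)
    have hσ : ∀ a b, pettyDist (σ a) (σ b) = pettyDist a b := pettyDist_reflect d (1 - d)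
    have s4 : σ (α 3) = (0, 0, 0) := by simp [σ, h4]
    have s5 : σ (α 4) = (0, d, 1 - d) := by simp [σ, h5]
    refine no_center_of_le hd₀ (by linarith) (a := σ (α 0)) (b := σ (α 1)) (c := σ (α 2))
      (q := σ q) (r := r) ?_ ?_ ?_ ?_ ?_ ?_ ?_ ?_ ?_ (sub_nonneg.2 h₄) (sub_le_sub_left h₃ _)
      (sub_le_sub_left h₂ _) (sub_le_self _ h₁) ?_ ?_ ?_ ?_ ?_ (sub_le_sub_left h _) <;>
      first
        | rw [← s4, hσ]
        | rw [← s5, hσ]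
        | rw [hσ]
    all_goals first | exact hq _ | exact hequi _ _ (by decide)
end

section
/- In the Petty space, let A₁ = (1/2, 0, 0), A₂ = (−1/2, 0, 0), A₃ = (0, √3/2, 0) and D = (0, √3/6, 1 − √3/3). Then the set {A₁, A₂, A₃, D} is 1-equilateral (all six pairwise distances equal 1) and it has no center: there is no point c ∈ ℝ³ and no r > 0 such that ‖c − A₁‖ = ‖c − A₂‖ = ‖c − A₃‖ = ‖c − D‖ = r. -/
theorem pettyDist_eq_of_sq {x y z x' y' z' u : ℝ} (hu : 0 ≤ u)
    (h : (x - x') ^ 2 + (y - y') ^ 2 = u ^ 2) :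
    pettyDist (x, y, z) (x', y', z') = u + |z - z'| := by
  change Real.sqrt ((x - x') ^ 2 + (y - y') ^ 2) + |z - z'| = _
  rw [h, Real.sqrt_sq hu]

/-- Points of equal height are Petty-equidistant from `c` only if their projections to the
horizontal plane are equidistant from that of `c`. -/
theorem sq_add_sq_eq_of_pettyDist_eq {x y z a b a' b' t : ℝ}
    (h : pettyDist (x, y, z) (a, b, t) = pettyDist (x, y, z) (a', b', t)) :
    (x - a) ^ 2 + (y - b) ^ 2 = (x - a') ^ 2 + (y - b') ^ 2 := by
  change Real.sqrt ((x - a) ^ 2 + (y - b) ^ 2) + |z - t| =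
    Real.sqrt ((x - a') ^ 2 + (y - b') ^ 2) + |z - t| at h
  exact (Real.sqrt_inj (by positivity) (by positivity)).1 (add_right_cancel h)

/-- the set {A₁, A₂, A₃, D} is 1-equilateral in the Petty space and has
no center. -/
theorem equilateral_four_no_center :
    let A₁ : ℝ × ℝ × ℝ := (1/2, 0, 0)
    let A₂ : ℝ × ℝ × ℝ := (-(1/2), 0, 0)
    let A₃ : ℝ × ℝ × ℝ := (0, Real.sqrt 3 / 2, 0)
    let D : ℝ × ℝ × ℝ := (0, Real.sqrt 3 / 6, 1 - Real.sqrt 3 / 3)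
    (pettyDist A₁ A₂ = 1 ∧ pettyDist A₁ A₃ = 1 ∧ pettyDist A₁ D = 1 ∧
     pettyDist A₂ A₃ = 1 ∧ pettyDist A₂ D = 1 ∧ pettyDist A₃ D = 1) ∧
    ¬ ∃ (c : ℝ × ℝ × ℝ) (r : ℝ), 0 < r ∧
      pettyDist c A₁ = r ∧ pettyDist c A₂ = r ∧ pettyDist c A₃ = r ∧ pettyDist c D = r := by
  intro A₁ A₂ A₃ D
  have hs : Real.sqrt 3 ^ 2 = 3 := Real.sq_sqrt (by norm_num)
  have hs0 : 0 < Real.sqrt 3 := Real.sqrt_pos.2 (by norm_num)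
  have hs_gt : 3 / 2 < Real.sqrt 3 := by nlinarith
  have hs_lt : Real.sqrt 3 < 3 := by nlinarith
  have hD : |0 - (1 - Real.sqrt 3 / 3)| = 1 - Real.sqrt 3 / 3 := by
    rw [zero_sub, abs_neg, abs_of_pos (by linarith)]
  refine ⟨⟨?_, ?_, ?_, ?_, ?_, ?_⟩, ?_⟩
  · rw [pettyDist_eq_of_sq (u := 1) (by norm_num) (by norm_num)]
    norm_num
  · rw [pettyDist_eq_of_sq (u := 1) (by norm_num) (by linarith)]
    norm_num
  · rw [pettyDist_eq_of_sq (u := Real.sqrt 3 / 3) (by positivity) (by linarith), hD]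
    ring
  · rw [pettyDist_eq_of_sq (u := 1) (by norm_num) (by linarith)]
    norm_num
  · rw [pettyDist_eq_of_sq (u := Real.sqrt 3 / 3) (by positivity) (by linarith), hD]
    ring
  · rw [pettyDist_eq_of_sq (u := Real.sqrt 3 / 3) (by positivity) (by linarith), hD]
    ring
  · rintro ⟨⟨x, y, z⟩, r, -, h₁, h₂, h₃, h₄⟩
    have h₁₂ := sq_add_sq_eq_of_pettyDist_eq (h₁.trans h₂.symm)
    have h₁₃ := sq_add_sq_eq_of_pettyDist_eq (h₁.trans h₃.symm)
    obtain rfl : x = 0 := by linarith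
    obtain rfl : y = Real.sqrt 3 / 6 :=
      mul_left_cancel₀ hs0.ne' (by linarith)
    have h := h₁.trans h₄.symm
    rw [pettyDist_eq_of_sq (u := Real.sqrt 3 / 3) (by positivity) (by linarith),
      pettyDist_eq_of_sq (u := 0) le_rfl (by ring), sub_zero] at h
    have htri := abs_sub z (1 - Real.sqrt 3 / 3)
    rw [abs_of_pos (show 0 < 1 - Real.sqrt 3 / 3 by linarith)] at htri
    linarith
end
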